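/- There exists a constant c(6) such that every simple undirected graph on n vertices with more than c(6)·n edges contains K_6 as a minor; consequently the maximum number of edges of a graph on n vertices with no K_6 minor is O(n). In the specific form due to Mader: every graph on n ≥ 6 vertices with more than 4n - 10 edges has a K_6 minor. -/

import Mathlib

/-- `G` has `K₆` as a minor: there are 6 nonempty pairwise disjoint branch sets,
each inducing a connected subgraph, with an edge of `G` between any two. -/
def HasK6Minor {V : Type*} (G : SimpleGraph V) : Prop :=
  ∃ B : Fin 6 → Set V,
    (∀ i, (B i).Nonempty) ∧
    (Pairwise fun i j => Disjoint (B i) (B j)) ∧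
    (∀ i, (G.induce (B i)).Connected) ∧
    (∀ i j, i ≠ j → ∃ u ∈ B i, ∃ v ∈ B j, G.Adj u v)


/-! ### Finite check -/

def forceN (x : ℕ) (k : ℕ → Bool) : Bool :=
  Nat.rec (k 0) (fun n _ => k (n + 1)) x

def forceL : List ℕ → (List ℕ → Bool) → Bool
  | [], k => k []
  | a :: l, k => forceN a fun a' => forceL l fun l' => k (a' :: l')

def forceLL : List (List ℕ) → (List (List ℕ) → Bool) → Bool
  | [], k => k []
  | a :: l, k => forceL a fun a' => forceLL l fun l' => k (a' :: l')

theorem forceN_eq (x : ℕ) (k : ℕ → Bool) : forceN x k = k x := by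
  cases x <;> rfl

theorem forceL_eq (l : List ℕ) : ∀ (k : List ℕ → Bool), forceL l k = k l := by
  induction l with
  | nil => intro k; rfl
  | cons a l ih => intro k; simp [forceL, forceN_eq, ih]

theorem forceLL_eq (l : List (List ℕ)) : ∀ (k : List (List ℕ) → Bool), forceLL l k = k l := by
  induction l with
  | nil => intro k; rfl
  | cons a l ih => intro k; simp [forceLL, forceL_eq, ih]

/-- The bit recording that `p` and `q` are not adjacent (eight bits per row). -/
def bit1 (p q : ℕ) : ℕ := if p = q then 0 else 1 <<< (8 * p + q)

def bit4 (p q : ℕ × ℕ) : ℕ := bit1 p.1 q.1 ||| bit1 p.1 q.2 ||| bit1 p.2 q.1 ||| bit1 p.2 q.2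

/-- A candidate `K₅` model: five vertices or pairs of vertices. -/
structure Cand where
  c1 : ℕ × ℕ
  c2 : ℕ × ℕ
  c3 : ℕ × ℕ
  c4 : ℕ × ℕ
  c5 : ℕ × ℕ

def pDisj (p q : ℕ × ℕ) : Bool :=
  p.1 != q.1 && p.1 != q.2 && p.2 != q.1 && p.2 != q.2

def pLt (n : ℕ) (p : ℕ × ℕ) : Bool := decide (p.1 < n) && decide (p.2 < n)

def Cand.valid (n : ℕ) (c : Cand) : Bool :=
  pLt n c.c1 && pLt n c.c2 && pLt n c.c3 && pLt n c.c4 && pLt n c.c5 &&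
  pDisj c.c1 c.c2 && pDisj c.c1 c.c3 && pDisj c.c1 c.c4 && pDisj c.c1 c.c5 &&
  pDisj c.c2 c.c3 && pDisj c.c2 c.c4 && pDisj c.c2 c.c5 &&
  pDisj c.c3 c.c4 && pDisj c.c3 c.c5 && pDisj c.c4 c.c5

def Cand.masks (c : Cand) : List ℕ :=
  [bit1 c.c1.1 c.c1.2 ||| bit1 c.c2.1 c.c2.2 ||| bit1 c.c3.1 c.c3.2 ||| bit1 c.c4.1 c.c4.2 |||
    bit1 c.c5.1 c.c5.2 ||| bit4 c.c3 c.c4 ||| bit4 c.c3 c.c5 ||| bit4 c.c4 c.c5,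
   bit4 c.c1 c.c3, bit4 c.c1 c.c4, bit4 c.c1 c.c5, bit4 c.c2 c.c3, bit4 c.c2 c.c4, bit4 c.c2 c.c5,
   bit4 c.c1 c.c2]

def linksOK (m : ℕ) : List ℕ → Bool
  | [] => true
  | k :: l => bif Nat.beq (Nat.land m k) k then false else linksOK m l

def maskTest (m : ℕ) : List ℕ → Bool
  | [] => false
  | a :: l => bif Nat.beq (Nat.land m a) 0 then linksOK m l else false

def mK5 (m : ℕ) : List (List ℕ) → Bool
  | [] => false
  | c :: cs => bif maskTest m c then true else mK5 m cs

def mAdj (m p q : ℕ) : Bool := !(Nat.testBit m (8 * p + q))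

/-- exceptional graphs -/
def mExc (n : ℕ) (cs : List (List ℕ)) (m : ℕ) : Bool :=
  ((List.range n).all fun u => (List.range n).all fun w =>
    mAdj m u w || forceN (m ^^^ (1 <<< (8 * u + w) ||| 1 <<< (8 * w + u))) fun m' => mK5 m' cs) &&
  ((List.range n).all fun i => (List.range i).all fun j => !(mAdj m i j) ||
    ((List.range j).all fun k => !(mAdj m i k) || !(mAdj m j k) ||
      (List.range k).all fun l => !(mAdj m i l) || !(mAdj m j l) || !(mAdj m k l))) &&
  decide (((List.range n).map fun i =>
    ((List.range n).countP fun j => mAdj m i j)).sum ≤ 7 * n - 12)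

def mLeaf (n : ℕ) (cs : List (List ℕ)) (m : ℕ) : Bool := bif mK5 m cs then true else mExc n cs m

def rowOK (n D i r : ℕ) : Bool :=
  !(r.testBit i) && decide (((List.range n).countP fun j => r.testBit j) ≤ D)

def lowBits (m i : ℕ) : ℕ → ℕ
  | 0 => 0
  | j + 1 => lowBits m i j ||| (((m >>> (8 * j + i)) &&& 1) <<< j)

def allRows (P : ℕ → Bool) (i low : ℕ) : List ℕ → Bool
  | [] => true
  | r :: l => bif Nat.beq (Nat.land r (2 ^ i - 1)) low then (bif P r then allRows P i low l else false)
      else allRows P i low l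

def mGo (n : ℕ) (cs : List (List ℕ)) : List (List ℕ) → ℕ → ℕ → Bool
  | [], _, m => mLeaf n cs m
  | rs :: R, i, m => forceN (lowBits m i i) fun low =>
      allRows (fun r => forceN (m ||| r <<< (8 * i)) fun m' => forceN (i + 1) fun i' =>
        mGo n cs R i' m') i low rs

def rowsOf (n D i : ℕ) : List ℕ :=
  if i = 0 then [2 ^ (D + 1) - 2] else (List.range (2 ^ n)).filter (rowOK n D i)

def mCheck (n D : ℕ) (cs : List Cand) : Bool :=
  forceLL (cs.map Cand.masks) fun cs' => forceLL ((List.range n).map (rowsOf n D)) fun R =>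
    mGo n cs' R 0 0

def cands6 : List Cand :=
  (List.range 6).flatMap fun a => (List.range 6).flatMap fun b =>
    if a < b then
      match (List.range 6).filter (fun s => s != a && s != b) with
      | [s, t, u, v] => [⟨(a, b), (s, s), (t, t), (u, u), (v, v)⟩]
      | _ => []
    else []

def cands7 : List Cand :=
  (List.range 7).flatMap fun a => (List.range 7).flatMap fun b =>
    if a < b then
      (List.range 7).flatMap fun c => (List.range 7).flatMap fun d =>
        if a < c && c < d && c != b && d != b then
        match (List.range 7).filter (fun s => s != a && s != b && s != c && s != d) with
        | [s, t, u] => [⟨(a, b), (c, d), (s, s), (t, t), (u, u)⟩]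
        | _ => []
        else []
    else []

theorem valid6 : cands6.all (Cand.valid 6) = true := by decide +kernel
theorem valid7 : cands7.all (Cand.valid 7) = true := by decide +kernel
theorem go60 : mCheck 6 0 cands6 = true := by decide +kernel
theorem go61 : mCheck 6 1 cands6 = true := by decide +kernel
theorem go70 : mCheck 7 0 cands7 = true := by decide +kernel
theorem go71 : mCheck 7 1 cands7 = true := by decide +kernel
set_option maxHeartbeats 4000000 in
theorem go72 : mCheck 7 2 cands7 = true := by decide +kernel


/-! ### Soundness of the finite check -/

/-- `A` restricted to `{0, …, n-1}` has a `K₅` model with branch sets of size at most two. -/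
def K5N (n : ℕ) (A : ℕ → ℕ → Prop) : Prop :=
  ∃ f : Fin 5 → ℕ × ℕ, (∀ i, (f i).1 < n ∧ (f i).2 < n) ∧
    (∀ i, (f i).1 = (f i).2 ∨ A (f i).1 (f i).2) ∧
    (∀ i j, i ≠ j → (f i).1 ≠ (f j).1 ∧ (f i).1 ≠ (f j).2 ∧ (f i).2 ≠ (f j).1 ∧
      (f i).2 ≠ (f j).2 ∧ (A (f i).1 (f j).1 ∨ A (f i).1 (f j).2 ∨ A (f i).2 (f j).1 ∨
        A (f i).2 (f j).2))

theorem land_zero_testBit {m a i : ℕ} (h : m &&& a = 0) (hi : a.testBit i = true) :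
    m.testBit i = false := by
  have := congrArg (fun x => Nat.testBit x i) h
  simpa [hi] using this

theorem land_zero_testBit' {m a : ℕ} (h : m &&& a = 0) :
    ∀ i, a.testBit i = true → m.testBit i = false := fun _ hi => land_zero_testBit h hi

theorem bit1_testBit {p q : ℕ} (h : p ≠ q) : (bit1 p q).testBit (8 * p + q) = true := by
  simp [bit1, h]

theorem testBit_of_bit1 {p q i : ℕ} (h : (bit1 p q).testBit i = true) : i = 8 * p + q := by
  unfold bit1 at h
  split at h
  · simp at h
  · rw [Nat.one_shiftLeft, Nat.testBit_two_pow] at h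
    simpa using (of_decide_eq_true h).symm

theorem bit4_link {m : ℕ} {P Q : ℕ × ℕ} (h : m &&& bit4 P Q ≠ bit4 P Q) :
    m.testBit (8 * P.1 + Q.1) = false ∨ m.testBit (8 * P.1 + Q.2) = false ∨
    m.testBit (8 * P.2 + Q.1) = false ∨ m.testBit (8 * P.2 + Q.2) = false := by
  by_contra hc
  push Not at hc
  simp only [ne_eq, Bool.not_eq_false] at hc
  apply h
  apply Nat.eq_of_testBit_eq
  intro i
  rw [Nat.testBit_land]
  by_cases hb : (bit4 P Q).testBit i = true
  · rw [hb, Bool.and_true]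
    unfold bit4 at hb
    simp only [Nat.testBit_or, Bool.or_eq_true] at hb
    rcases hb with ((hb | hb) | hb) | hb <;> rw [testBit_of_bit1 hb] <;> tauto
  · simp [hb]

theorem pDisj_ne {p q : ℕ × ℕ} (h : pDisj p q = true) :
    p.1 ≠ q.1 ∧ p.1 ≠ q.2 ∧ p.2 ≠ q.1 ∧ p.2 ≠ q.2 := by
  simp [pDisj] at h; tauto

set_option maxHeartbeats 1000000 in
theorem cand_sound {n m : ℕ} {A : ℕ → ℕ → Prop} (hs : ∀ i j, A i j → A j i)
    (hA : ∀ i j, i < n → j < n → i ≠ j → m.testBit (8 * i + j) = false → A i j)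
    (c : Cand) (hv : c.valid n = true) (ht : maskTest m c.masks = true) : K5N n A := by
  obtain ⟨c1, c2, c3, c4, c5⟩ := c
  simp only [Cand.valid, Bool.and_eq_true] at hv
  simp only [Cand.masks, maskTest, linksOK, cond_eq_ite, Nat.beq_eq] at ht
  have hland : ∀ x y : ℕ, Nat.land x y = x &&& y := fun _ _ => rfl
  simp only [hland] at ht
  obtain ⟨⟨⟨⟨⟨⟨⟨⟨⟨⟨⟨⟨⟨⟨l1, l2⟩, l3⟩, l4⟩, l5⟩, d12⟩, d13⟩, d14⟩, d15⟩, d23⟩, d24⟩, d25⟩, d34⟩,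
    d35⟩, d45⟩ := hv
  simp only [pLt, Bool.and_eq_true, decide_eq_true_eq] at l1 l2 l3 l4 l5
  replace d12 := pDisj_ne d12
  replace d13 := pDisj_ne d13
  replace d14 := pDisj_ne d14
  replace d15 := pDisj_ne d15
  replace d23 := pDisj_ne d23
  replace d24 := pDisj_ne d24
  replace d25 := pDisj_ne d25
  replace d34 := pDisj_ne d34
  replace d35 := pDisj_ne d35
  replace d45 := pDisj_ne d45
  split at ht
  case isFalse => simp at ht
  case isTrue h0 =>
  split at ht
  · simp at ht
  rename_i k13
  split at ht
  · simp at ht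
  rename_i k14
  split at ht
  · simp at ht
  rename_i k15
  split at ht
  · simp at ht
  rename_i k23
  split at ht
  · simp at ht
  rename_i k24
  split at ht
  · simp at ht
  rename_i k25
  split at ht
  · simp at ht
  rename_i k12
  replace k12 := bit4_link k12
  replace k13 := bit4_link k13
  replace k14 := bit4_link k14
  replace k15 := bit4_link k15
  replace k23 := bit4_link k23
  replace k24 := bit4_link k24
  replace k25 := bit4_link k25
  have conn : ∀ p : ℕ × ℕ, p.1 < n ∧ p.2 < n →
      (p.1 ≠ p.2 → m.testBit (8 * p.1 + p.2) = false) → p.1 = p.2 ∨ A p.1 p.2 := by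
    intro p hp h
    by_cases he : p.1 = p.2
    · exact Or.inl he
    · exact Or.inr (hA _ _ hp.1 hp.2 he (h he))
  have link : ∀ p q : ℕ × ℕ, p.1 < n ∧ p.2 < n → q.1 < n ∧ q.2 < n →
      (p.1 ≠ q.1 ∧ p.1 ≠ q.2 ∧ p.2 ≠ q.1 ∧ p.2 ≠ q.2) →
      (m.testBit (8 * p.1 + q.1) = false ∨ m.testBit (8 * p.1 + q.2) = false ∨
        m.testBit (8 * p.2 + q.1) = false ∨ m.testBit (8 * p.2 + q.2) = false) →
      (p.1 ≠ q.1 ∧ p.1 ≠ q.2 ∧ p.2 ≠ q.1 ∧ p.2 ≠ q.2 ∧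
        (A p.1 q.1 ∨ A p.1 q.2 ∨ A p.2 q.1 ∨ A p.2 q.2)) := by
    rintro p q ⟨hp1, hp2⟩ ⟨hq1, hq2⟩ ⟨h1, h2, h3, h4⟩ h
    refine ⟨h1, h2, h3, h4, ?_⟩
    rcases h with h | h | h | h
    · exact Or.inl (hA _ _ hp1 hq1 h1 h)
    · exact Or.inr (Or.inl (hA _ _ hp1 hq2 h2 h))
    · exact Or.inr (Or.inr (Or.inl (hA _ _ hp2 hq1 h3 h)))
    · exact Or.inr (Or.inr (Or.inr (hA _ _ hp2 hq2 h4 h)))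
  have sym : ∀ p q : ℕ × ℕ, (p.1 ≠ q.1 ∧ p.1 ≠ q.2 ∧ p.2 ≠ q.1 ∧ p.2 ≠ q.2 ∧
        (A p.1 q.1 ∨ A p.1 q.2 ∨ A p.2 q.1 ∨ A p.2 q.2)) →
      (q.1 ≠ p.1 ∧ q.1 ≠ p.2 ∧ q.2 ≠ p.1 ∧ q.2 ≠ p.2 ∧
        (A q.1 p.1 ∨ A q.1 p.2 ∨ A q.2 p.1 ∨ A q.2 p.2)) := by
    rintro p q ⟨h1, h2, h3, h4, h⟩
    refine ⟨h1.symm, h3.symm, h2.symm, h4.symm, ?_⟩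
    rcases h with h | h | h | h
    · exact Or.inl (hs _ _ h)
    · exact Or.inr (Or.inr (Or.inl (hs _ _ h)))
    · exact Or.inr (Or.inl (hs _ _ h))
    · exact Or.inr (Or.inr (Or.inr (hs _ _ h)))
  have z := land_zero_testBit' h0
  simp only [Nat.testBit_or, Bool.or_eq_true] at z
  have z34 : ∀ p q : ℕ × ℕ, p.1 ≠ q.1 → (bit4 p q).testBit (8 * p.1 + q.1) = true := by
    intro p q h
    simp [bit4, bit1_testBit h]
  have m12 := link c1 c2 l1 l2 d12 k12
  have m13 := link c1 c3 l1 l3 d13 k13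
  have m14 := link c1 c4 l1 l4 d14 k14
  have m15 := link c1 c5 l1 l5 d15 k15
  have m23 := link c2 c3 l2 l3 d23 k23
  have m24 := link c2 c4 l2 l4 d24 k24
  have m25 := link c2 c5 l2 l5 d25 k25
  have m34 := link c3 c4 l3 l4 d34 (Or.inl (z _ (by simp only [z34 _ _ d34.1, or_true, true_or])))
  have m35 := link c3 c5 l3 l5 d35 (Or.inl (z _ (by simp only [z34 _ _ d35.1, or_true, true_or])))
  have m45 := link c4 c5 l4 l5 d45 (Or.inl (z _ (by simp only [z34 _ _ d45.1, or_true, true_or])))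
  have e1 := conn c1 l1 (fun h => z _ (by simp only [bit1_testBit h, or_true, true_or]))
  have e2 := conn c2 l2 (fun h => z _ (by simp only [bit1_testBit h, or_true, true_or]))
  have e3 := conn c3 l3 (fun h => z _ (by simp only [bit1_testBit h, or_true, true_or]))
  have e4 := conn c4 l4 (fun h => z _ (by simp only [bit1_testBit h, or_true, true_or]))
  have e5 := conn c5 l5 (fun h => z _ (by simp only [bit1_testBit h, or_true, true_or]))
  refine ⟨![c1, c2, c3, c4, c5], ?_, ?_, ?_⟩
  · intro i; fin_cases i
    exacts [l1, l2, l3, l4, l5]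
  · intro i; fin_cases i
    exacts [e1, e2, e3, e4, e5]
  · intro i j hij
    fin_cases i <;> fin_cases j <;> first | exact absurd rfl hij | skip
    exacts [m12, m13, m14, m15, sym _ _ m12, m23, m24, m25, sym _ _ m13, sym _ _ m23, m34, m35,
      sym _ _ m14, sym _ _ m24, sym _ _ m34, m45, sym _ _ m15, sym _ _ m25, sym _ _ m35,
      sym _ _ m45]

theorem mK5_sound {n m : ℕ} {A : ℕ → ℕ → Prop} (hs : ∀ i j, A i j → A j i)
    (hA : ∀ i j, i < n → j < n → i ≠ j → m.testBit (8 * i + j) = false → A i j)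
    (cs : List Cand) (hv : cs.all (Cand.valid n) = true)
    (ht : mK5 m (cs.map Cand.masks) = true) : K5N n A := by
  induction cs with
  | nil => simp [mK5] at ht
  | cons c cs ih =>
    simp only [List.all_cons, Bool.and_eq_true] at hv
    simp only [List.map_cons, mK5, cond_eq_ite] at ht
    split at ht
    · exact cand_sound hs hA c hv.1 (by assumption)
    · exact ih hv.2 ht

/-- The conclusion of the finite check. -/
def FinConcl (n : ℕ) (A : ℕ → ℕ → Prop) : Prop :=
  K5N n A ∨
    ((∀ u w, u < n → w < n → u ≠ w → ¬ A u w →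
        K5N n (fun i j => A i j ∨ (i = u ∧ j = w) ∨ (i = w ∧ j = u))) ∧
      (∀ i j k l, i < n → j < i → k < j → l < k →
        ¬ (A i j ∧ A i k ∧ A j k ∧ A i l ∧ A j l ∧ A k l)) ∧
      ∀ [DecidableRel A], ∑ i ∈ Finset.range n, ((Finset.range n).filter
        (fun j => j = i ∨ A i j)).card ≤ 7 * n - 12)

theorem countP_range (p : ℕ → Bool) (n : ℕ) :
    (List.range n).countP p = ((Finset.range n).filter (fun j => p j = true)).card := by
  induction n with
  | zero => simp
  | succ n ih =>
    rw [List.range_succ, List.countP_append, ih, Finset.range_add_one, Finset.filter_insert]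
    split <;> simp_all

theorem sum_range_list (f : ℕ → ℕ) (n : ℕ) :
    ((List.range n).map f).sum = ∑ i ∈ Finset.range n, f i := by
  induction n with
  | zero => simp
  | succ n ih => rw [List.range_succ, List.map_append, List.sum_append, ih, Finset.sum_range_succ]; simp

theorem mLeaf_sound {n m : ℕ} (hn : n ≤ 8) {A : ℕ → ℕ → Prop} (hs : ∀ i j, A i j → A j i)
    (hA : ∀ i j, i < n → j < n → (m.testBit (8 * i + j) = true ↔ i ≠ j ∧ ¬ A i j))
    (cs : List Cand) (hv : cs.all (Cand.valid n) = true)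
    (ht : mLeaf n (cs.map Cand.masks) m = true) : FinConcl n A := by
  have hadj : ∀ i j, i < n → j < n → (mAdj m i j = true ↔ j = i ∨ A i j) := by
    intro i j hi hj
    have := hA i j hi hj
    unfold mAdj
    by_cases h : m.testBit (8 * i + j) = true
    · simp [h]; have := this.1 h; grind
    · have h2 := mt this.2 h; simp at h; simp [h]; tauto
  unfold mLeaf at ht
  rw [cond_eq_ite] at ht
  split at ht
  · left
    refine mK5_sound hs ?_ cs hv (by assumption)
    intro i j hi hj hij h
    have := hA i j hi hj
    simp [h] at this
    exact this hij
  · right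
    simp only [mExc, Bool.and_eq_true] at ht
    obtain ⟨⟨h1, h2⟩, h3⟩ := ht
    refine ⟨?_, ?_, ?_⟩
    · intro u w hu hw huw hnA
      simp only [List.all_eq_true, List.mem_range, Bool.or_eq_true, forceN_eq] at h1
      rcases h1 u hu w hw with h | h
      · rw [hadj u w hu hw] at h
        grind
      · refine mK5_sound ?_ ?_ cs hv h
        · intro i j hij
          have := hs i j
          tauto
        · intro i j hi hj hij hb
          by_cases hc : (i = u ∧ j = w) ∨ (i = w ∧ j = u)
          · exact Or.inr hc
          left
          have e1 : 8 * u + w ≠ 8 * i + j := by omega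
          have e2 : 8 * w + u ≠ 8 * i + j := by omega
          rw [Nat.testBit_xor, Nat.testBit_or, Nat.one_shiftLeft, Nat.one_shiftLeft,
            Nat.testBit_two_pow, Nat.testBit_two_pow] at hb
          simp [e1, e2] at hb
          have := hA i j hi hj
          simp [hb] at this
          exact this hij
    · rintro i j k l hi hj hk hl ⟨a1, a2, a3, a4, a5, a6⟩
      simp only [List.all_eq_true, List.mem_range, Bool.or_eq_true, Bool.not_eq_true',
        ← Bool.not_eq_true] at h2
      have hj' : j < n := by omega
      have hk' : k < n := by omega
      have hl' : l < n := by omega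
      have b1 := (hadj i j hi hj').2 (Or.inr a1)
      have b2 := (hadj i k hi hk').2 (Or.inr a2)
      have b3 := (hadj j k hj' hk').2 (Or.inr a3)
      have b4 := (hadj i l hi hl').2 (Or.inr a4)
      have b5 := (hadj j l hj' hl').2 (Or.inr a5)
      have b6 := (hadj k l hk' hl').2 (Or.inr a6)
      have := h2 i hi j hj
      simp [b1] at this
      have := this k hk
      simp [b2, b3] at this
      have := this l hl
      simp [b4, b5, b6] at this
    · intro _
      have h3 := of_decide_eq_true h3
      refine le_trans (le_of_eq ?_) h3
      rw [sum_range_list]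
      apply Finset.sum_congr rfl
      intro i hi
      rw [countP_range]
      congr 1
      apply Finset.filter_congr
      intro j hj
      rw [hadj i j (Finset.mem_range.1 hi) (Finset.mem_range.1 hj)]

def pack (ρ : ℕ → ℕ) : ℕ → ℕ
  | 0 => 0
  | i + 1 => pack ρ i ||| ρ i <<< (8 * i)

theorem pack_testBit {ρ : ℕ → ℕ} {N : ℕ} (hρ : ∀ i < N, ρ i < 2 ^ 8) (i : ℕ) (hi : i ≤ N)
    (j t : ℕ) (ht : t < 8) :
    (pack ρ i).testBit (8 * j + t) = (decide (j < i) && (ρ j).testBit t) := by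
  induction i with
  | zero => simp [pack]
  | succ i ih =>
    rw [pack, Nat.testBit_or, ih (by omega), Nat.testBit_shiftLeft]
    rcases lt_trichotomy j i with h | h | h
    · have e1 : ¬ (8 * i ≤ 8 * j + t) := by omega
      have e2 : j < i + 1 := by omega
      simp [h, e1, e2]
    · subst h
      simp
    · have e1 : (8 * i ≤ 8 * j + t) := by omega
      have e2 : ¬ j < i + 1 := by omega
      have e3 : ¬ j < i := by omega
      have : (ρ i).testBit (8 * j + t - 8 * i) = false :=
        Nat.testBit_lt_two_pow (lt_of_lt_of_le (hρ i (by omega))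
          (Nat.pow_le_pow_right (by norm_num) (by omega)))
      simp [e1, e2, e3, this]

theorem lowBits_testBit (m i k t : ℕ) :
    (lowBits m i k).testBit t = (decide (t < k) && m.testBit (8 * t + i)) := by
  induction k with
  | zero => simp [lowBits]
  | succ k ih =>
    rw [lowBits, Nat.testBit_or, ih, Nat.testBit_shiftLeft]
    rcases lt_trichotomy t k with h | h | h
    · have e1 : ¬ (k ≤ t) := by omega
      have e2 : t < k + 1 := by omega
      simp [h, e1, e2]
    · subst h
      simp
    · have e1 : k ≤ t := by omega
      have e2 : ¬ t < k + 1 := by omega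
      have e3 : ¬ t < k := by omega
      have e4 : t - k ≠ 0 := by omega
      have : (m >>> (8 * k + i) &&& 1).testBit (t - k) = false := by
        have h1 : Nat.testBit 1 (t - k) = false :=
          Nat.testBit_lt_two_pow (Nat.one_lt_two_pow e4)
        rw [Nat.testBit_and, h1, Bool.and_false]
      rw [this]
      simp [e2, e3]

theorem allRows_sound {P : ℕ → Bool} {i low : ℕ} {l : List ℕ} (h : allRows P i low l = true)
    {r : ℕ} (hr : r ∈ l) (hl : r &&& (2 ^ i - 1) = low) : P r = true := by
  induction l with
  | nil => simp at hr
  | cons a l ih =>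
    simp only [allRows, cond_eq_ite, Nat.beq_eq] at h
    rcases List.mem_cons.1 hr with rfl | hr
    · have : Nat.land r (2 ^ i - 1) = low := hl
      rw [if_pos this] at h
      split at h
      · assumption
      · simp at h
    · apply ih _ hr
      split at h
      · split at h
        · exact h
        · simp at h
      · exact h

theorem mGo_sound {n N : ℕ} (hN : N ≤ 8) {cs : List (List ℕ)} {ρ : ℕ → ℕ} {rows : ℕ → List ℕ}
    (hρ : ∀ i < N, ρ i < 2 ^ 8) (hrow : ∀ i < N, ρ i ∈ rows i)
    (hsym : ∀ i < N, ∀ j < N, (ρ i).testBit j = (ρ j).testBit i) (k i : ℕ) (hk : i + k = N)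
    (h : mGo n cs ((List.range' i k).map rows) i (pack ρ i) = true) :
    mLeaf n cs (pack ρ N) = true := by
  induction k generalizing i with
  | zero =>
    obtain rfl : i = N := by omega
    simpa [mGo] using h
  | succ k ih =>
    simp only [List.range'_succ, List.map_cons, mGo, forceN_eq] at h
    have := allRows_sound h (hrow i (by omega)) (by
      apply Nat.eq_of_testBit_eq
      intro t
      rw [Nat.testBit_and, lowBits_testBit, Nat.testBit_two_pow_sub_one]
      by_cases ht : t < i
      · rw [pack_testBit hρ i (by omega) t i (by omega)]
        simp [ht, hsym i (by omega) t (by omega)]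
      · simp [ht])
    exact ih (i + 1) (by omega) this

open Classical in
noncomputable def rowMask (B : ℕ → Prop) : ℕ → ℕ
  | 0 => 0
  | j + 1 => rowMask B j ||| (if B j then 1 <<< j else 0)

theorem rowMask_testBit (B : ℕ → Prop) (n t : ℕ) :
    (rowMask B n).testBit t = true ↔ t < n ∧ B t := by
  induction n with
  | zero => simp [rowMask]
  | succ n ih =>
    rw [rowMask, Nat.testBit_or, Bool.or_eq_true, ih]
    split
    · rw [Nat.one_shiftLeft, Nat.testBit_two_pow]
      simp
      constructor
      · rintro (h | rfl)
        · exact ⟨by omega, h.2⟩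
        · exact ⟨by omega, by assumption⟩
      · rintro ⟨h, h'⟩
        by_cases e : n = t
        · exact Or.inr e
        · exact Or.inl ⟨by omega, h'⟩
    · simp
      rename_i hB
      intro hBt
      have : t ≠ n := by rintro rfl; exact hB hBt
      omega

open Classical in
theorem mCheck_sound {n D : ℕ} (hn : n ≤ 8) (hD : D < n) {cs : List Cand}
    (hv : cs.all (Cand.valid n) = true) (hc : mCheck n D cs = true)
    {A : ℕ → ℕ → Prop} (hs : ∀ i j, A i j → A j i)
    (h0 : ∀ j < n, (j ≠ 0 ∧ ¬ A 0 j) ↔ (1 ≤ j ∧ j ≤ D))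
    (hr : ∀ i < n, ((Finset.range n).filter (fun j => j ≠ i ∧ ¬ A i j)).card ≤ D) :
    FinConcl n A := by
  have hss : ∀ i j, A i j ↔ A j i := fun i j => ⟨hs i j, hs j i⟩
  simp only [mCheck, forceLL_eq, List.range_eq_range'] at hc
  have hlt : ∀ i, rowMask (fun j => j ≠ i ∧ ¬ A i j) n < 2 ^ n := by
    intro i
    apply Nat.lt_pow_two_of_testBit
    intro t ht
    rw [← Bool.not_eq_true, rowMask_testBit]
    omega
  have hlt8 : ∀ i < n, rowMask (fun j => j ≠ i ∧ ¬ A i j) n < 2 ^ 8 := fun i _ =>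
    lt_of_lt_of_le (hlt i) (Nat.pow_le_pow_right (by norm_num) hn)
  have := mGo_sound (ρ := fun i => rowMask (fun j => j ≠ i ∧ ¬ A i j) n) hn
    (rows := rowsOf n D) hlt8 ?_ ?_ n 0 (by omega) hc
  · refine mLeaf_sound hn hs ?_ cs hv this
    intro i j hi hj
    rw [pack_testBit hlt8 n le_rfl i j (by omega)]
    simp only [hi, decide_true, Bool.true_and, rowMask_testBit, hj, true_and]
    grind
  · intro i hi
    unfold rowsOf
    split
    · subst_vars
      rw [List.mem_singleton]
      apply Nat.eq_of_testBit_eq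
      intro t
      have e : 2 ^ (D + 1) - 2 = 2 ^ 1 * (2 ^ D - 1) := by
        rw [pow_succ, Nat.mul_sub]; omega
      rw [e, Nat.testBit_two_pow_mul, Nat.testBit_two_pow_sub_one, Bool.eq_iff_iff,
        rowMask_testBit]
      simp only [ge_iff_le, Bool.and_eq_true, decide_eq_true_eq]
      constructor
      · rintro ⟨ht, h⟩
        have := (h0 t ht).1 h
        omega
      · rintro ⟨h1, h2⟩
        have ht : t < n := by omega
        exact ⟨ht, (h0 t ht).2 ⟨h1, by omega⟩⟩
    · rw [List.mem_filter, List.mem_range]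
      refine ⟨hlt i, ?_⟩
      simp only [rowOK, Bool.and_eq_true, decide_eq_true_eq, Bool.not_eq_true',
        ← Bool.not_eq_true, rowMask_testBit]
      refine ⟨by tauto, ?_⟩
      refine le_trans (le_of_eq ?_) (hr i hi)
      rw [countP_range]
      congr 1
      apply Finset.filter_congr
      intro j hj
      rw [rowMask_testBit]
      simp [Finset.mem_range.1 hj]
  · intro i hi j hj
    rw [Bool.eq_iff_iff, rowMask_testBit, rowMask_testBit, hss]
    grind

open Classical in
theorem fin_check {n D : ℕ} (hn : (n = 6 ∧ D ≤ 1) ∨ (n = 7 ∧ D ≤ 2))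
    {A : ℕ → ℕ → Prop} (hs : ∀ i j, A i j → A j i)
    (h0 : ∀ j < n, (j ≠ 0 ∧ ¬ A 0 j) ↔ (1 ≤ j ∧ j ≤ D))
    (hr : ∀ i < n, ((Finset.range n).filter (fun j => j ≠ i ∧ ¬ A i j)).card ≤ D) :
    FinConcl n A := by
  rcases hn with ⟨rfl, hD⟩ | ⟨rfl, hD⟩
  · interval_cases D
    · exact mCheck_sound (by norm_num) (by norm_num) valid6 go60 hs h0 hr
    · exact mCheck_sound (by norm_num) (by norm_num) valid6 go61 hs h0 hr
  · interval_cases D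
    · exact mCheck_sound (by norm_num) (by norm_num) valid7 go70 hs h0 hr
    · exact mCheck_sound (by norm_num) (by norm_num) valid7 go71 hs h0 hr
    · exact mCheck_sound (by norm_num) (by norm_num) valid7 go72 hs h0 hr


/-! ### Minors -/

def MinorOf {W V : Type*} (H : SimpleGraph W) (G : SimpleGraph V) : Prop :=
  ∃ B : W → Set V, (∀ w, (G.induce (B w)).Preconnected) ∧
    (Pairwise fun i j => Disjoint (B i) (B j)) ∧
    ∀ a b, H.Adj a b → ∃ u ∈ B a, ∃ v ∈ B b, G.Adj u v

theorem reach_mono {V : Type*} {G : SimpleGraph V} {S T : Set V} (h : S ⊆ T) {a b : V}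
    {ha : a ∈ S} {hb : b ∈ S} (hr : (G.induce S).Reachable ⟨a, ha⟩ ⟨b, hb⟩) :
    (G.induce T).Reachable ⟨a, h ha⟩ ⟨b, h hb⟩ :=
  hr.map (SimpleGraph.induceHomOfLE G h).toHom

theorem MinorOf.hasK6 {W V : Type*} {H : SimpleGraph W} {G : SimpleGraph V} (h : MinorOf H G)
    (hK : HasK6Minor H) : HasK6Minor G := by
  obtain ⟨B, hBc, hBd, hBe⟩ := h
  obtain ⟨K, hKn, hKd, hKc, hKe⟩ := hK
  have hedge : ∀ i j, i ≠ j → ∃ u ∈ ⋃ w ∈ K i, B w, ∃ v ∈ ⋃ w ∈ K j, B w, G.Adj u v := by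
    intro i j hij
    obtain ⟨a, ha, b, hb, hab⟩ := hKe i j hij
    obtain ⟨u, hu, v, hv, huv⟩ := hBe a b hab
    exact ⟨u, Set.mem_biUnion ha hu, v, Set.mem_biUnion hb hv, huv⟩
  have hne : ∀ i, (⋃ w ∈ K i, B w).Nonempty := by
    intro i
    obtain ⟨j, hj⟩ : ∃ j : Fin 6, i ≠ j := by
      by_cases h0 : i = 0
      · exact ⟨1, by subst h0; decide⟩
      · exact ⟨0, h0⟩
    obtain ⟨u, hu, _⟩ := hedge i j hj
    exact ⟨u, hu⟩
  refine ⟨fun i => ⋃ w ∈ K i, B w, hne, ?_, ?_, hedge⟩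
  · intro i j hij
    rw [Set.disjoint_left]
    intro v hv hv'
    simp only [Set.mem_iUnion] at hv hv'
    obtain ⟨a, ha, hva⟩ := hv
    obtain ⟨b, hb, hvb⟩ := hv'
    by_cases hab : a = b
    · subst hab
      exact Set.disjoint_left.1 (hKd hij) ha hb
    · exact Set.disjoint_left.1 (hBd hab) hva hvb
  · intro i
    have hsub : ∀ w ∈ K i, B w ⊆ ⋃ w ∈ K i, B w := fun w hw => Set.subset_biUnion_of_mem hw
    rw [SimpleGraph.connected_iff]
    refine ⟨?_, (hne i).to_subtype⟩
    rintro ⟨a, ha⟩ ⟨b, hb⟩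
    obtain ⟨w, hw, haw⟩ := Set.mem_iUnion₂.1 ha
    obtain ⟨w', hw', hbw⟩ := Set.mem_iUnion₂.1 hb
    have hr := (hKc i).preconnected ⟨w, hw⟩ ⟨w', hw'⟩
    rw [SimpleGraph.reachable_iff_reflTransGen] at hr
    have key : ∀ z : K i, Relation.ReflTransGen (H.induce (K i)).Adj ⟨w, hw⟩ z →
        ∀ c (hc : c ∈ B z.1), (G.induce (⋃ w ∈ K i, B w)).Reachable ⟨a, ha⟩
          ⟨c, hsub z.1 z.2 hc⟩ := by
      intro z hz
      induction hz with
      | refl =>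
        intro c hc
        exact reach_mono (hsub w hw) (hBc w ⟨a, haw⟩ ⟨c, hc⟩)
      | @tail y z _ hyz ih =>
        intro c hc
        obtain ⟨u, hu, v, hv, huv⟩ := hBe y.1 z.1 hyz
        have h1 := ih u hu
        have h2 : (G.induce (⋃ w ∈ K i, B w)).Adj ⟨u, hsub y.1 y.2 hu⟩ ⟨v, hsub z.1 z.2 hv⟩ := huv
        exact (h1.trans h2.reachable).trans (reach_mono (hsub z.1 z.2) (hBc z.1 ⟨v, hv⟩ ⟨c, hc⟩))
    exact key ⟨w', hw'⟩ hr b hbw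

theorem preconn_singleton {V : Type*} (G : SimpleGraph V) (a : V) :
    (G.induce ({a} : Set V)).Preconnected := by
  rintro ⟨x, hx⟩ ⟨y, hy⟩
  obtain rfl : x = a := hx
  obtain rfl : y = x := hy
  exact SimpleGraph.Reachable.refl _

theorem preconn_empty {V : Type*} (G : SimpleGraph V) :
    (G.induce (∅ : Set V)).Preconnected := by
  rintro ⟨x, hx⟩
  exact absurd hx (Set.notMem_empty x)

theorem conn_pair {V : Type*} (G : SimpleGraph V) (a b : V) (h : a = b ∨ G.Adj a b) :
    (G.induce ({a, b} : Set V)).Connected := by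
  rcases h with rfl | h
  · rw [SimpleGraph.connected_iff]
    refine ⟨?_, ⟨⟨a, by simp⟩⟩⟩
    rw [Set.pair_eq_singleton]
    exact preconn_singleton G a
  · exact SimpleGraph.induce_pair_connected_of_adj h

theorem hasK6_mono {V : Type*} {H G : SimpleGraph V} (h : H ≤ G) (hK : HasK6Minor H) :
    HasK6Minor G := by
  refine MinorOf.hasK6 ⟨fun w => {w}, fun w => preconn_singleton G w, ?_, ?_⟩ hK
  · intro i j hij
    simpa using hij
  · intro a b hab
    exact ⟨a, rfl, b, rfl, h hab⟩

theorem K6_of_K5N {V : Type*} (G : SimpleGraph V) (x : V) (p : ℕ → V) (n : ℕ)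
    (hinj : ∀ i j, i < n → j < n → p i = p j → i = j) (hx : ∀ i < n, G.Adj x (p i))
    (A : ℕ → ℕ → Prop) (hA : ∀ i j, i < n → j < n → A i j → G.Adj (p i) (p j))
    (h : K5N n A) : HasK6Minor G := by
  obtain ⟨f, hlt, hc, hd⟩ := h
  have hcross : ∀ i j, i ≠ j → ∃ u ∈ ({p (f i).1, p (f i).2} : Set V),
      ∃ v ∈ ({p (f j).1, p (f j).2} : Set V), G.Adj u v := by
    intro i j hij
    obtain ⟨_, _, _, _, h⟩ := hd i j hij
    rcases h with h | h | h | h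
    · exact ⟨_, Or.inl rfl, _, Or.inl rfl, hA _ _ (hlt i).1 (hlt j).1 h⟩
    · exact ⟨_, Or.inl rfl, _, Or.inr rfl, hA _ _ (hlt i).1 (hlt j).2 h⟩
    · exact ⟨_, Or.inr rfl, _, Or.inl rfl, hA _ _ (hlt i).2 (hlt j).1 h⟩
    · exact ⟨_, Or.inr rfl, _, Or.inr rfl, hA _ _ (hlt i).2 (hlt j).2 h⟩
  have hdisj : ∀ i j, i ≠ j → Disjoint ({p (f i).1, p (f i).2} : Set V)
      ({p (f j).1, p (f j).2} : Set V) := by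
    intro i j hij
    obtain ⟨h1, h2, h3, h4, _⟩ := hd i j hij
    rw [Set.disjoint_left]
    rintro v (rfl | rfl) (h | h)
    · exact h1 (hinj _ _ (hlt i).1 (hlt j).1 h)
    · exact h2 (hinj _ _ (hlt i).1 (hlt j).2 h)
    · exact h3 (hinj _ _ (hlt i).2 (hlt j).1 h)
    · exact h4 (hinj _ _ (hlt i).2 (hlt j).2 h)
  have hxd : ∀ i, x ∉ ({p (f i).1, p (f i).2} : Set V) := by
    rintro i (h | h)
    · exact (hx _ (hlt i).1).ne h
    · exact (hx _ (hlt i).2).ne h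
  refine ⟨Fin.cons {x} (fun i => {p (f i).1, p (f i).2}), ?_, ?_, ?_, ?_⟩
  · intro i
    refine Fin.cases ?_ (fun i => ?_) i
    · simp
    · exact ⟨p (f i).1, Or.inl rfl⟩
  · intro i j
    refine Fin.cases ?_ (fun i => ?_) i <;> refine Fin.cases ?_ (fun j => ?_) j
    · intro h; exact absurd rfl h
    · intro _
      simp only [Fin.cons_zero, Fin.cons_succ]
      exact Set.disjoint_singleton_left.2 (hxd j)
    · intro _
      simp only [Fin.cons_zero, Fin.cons_succ]
      exact Set.disjoint_singleton_right.2 (hxd i)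
    · intro h
      simp only [Fin.cons_succ]
      exact hdisj i j (fun e => h (by rw [e]))
  · intro i
    refine Fin.cases ?_ (fun i => ?_) i
    · rw [Fin.cons_zero, SimpleGraph.connected_iff]
      exact ⟨preconn_singleton G x, ⟨⟨x, rfl⟩⟩⟩
    · rw [Fin.cons_succ]
      apply conn_pair
      rcases hc i with h | h
      · left; rw [h]
      · right; exact hA _ _ (hlt i).1 (hlt i).2 h
  · intro i j
    refine Fin.cases ?_ (fun i => ?_) i <;> refine Fin.cases ?_ (fun j => ?_) j
    · intro h; exact absurd rfl h
    · intro _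
      exact ⟨x, rfl, p (f j).1, Or.inl rfl, hx _ (hlt j).1⟩
    · intro _
      exact ⟨p (f i).1, Or.inl rfl, x, rfl, (hx _ (hlt i).1).symm⟩
    · intro h
      exact hcross i j (fun e => h (by rw [e]))

/-- Contraction of the edge `uv` onto `u`. -/
def contr {V : Type*} (G : SimpleGraph V) (u v : V) : SimpleGraph V where
  Adj a b := a ≠ b ∧ a ≠ v ∧ b ≠ v ∧
    (G.Adj a b ∨ (a = u ∧ G.Adj v b) ∨ (b = u ∧ G.Adj v a))
  symm := ⟨by
    rintro a b ⟨h1, h2, h3, h4⟩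
    refine ⟨h1.symm, h3, h2, ?_⟩
    rcases h4 with h | h | h
    · exact Or.inl h.symm
    · exact Or.inr (Or.inr h)
    · exact Or.inr (Or.inl h)⟩
  loopless := ⟨fun a h => h.1 rfl⟩

open Classical in
theorem contr_minor {V : Type*} (G : SimpleGraph V) {u v : V} (h : G.Adj u v) :
    MinorOf (contr G u v) G := by
  have huv : u ≠ v := h.ne
  refine ⟨fun w => if w = u then {u, v} else if w = v then ∅ else {w}, ?_, ?_, ?_⟩
  · intro w
    dsimp only
    by_cases hu : w = u
    · rw [if_pos hu]
      exact (conn_pair G u v (Or.inr h)).preconnected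
    by_cases hv : w = v
    · rw [if_neg hu, if_pos hv]
      exact preconn_empty G
    · rw [if_neg hu, if_neg hv]
      exact preconn_singleton G w
  · intro i j hij
    dsimp only
    rw [Set.disjoint_left]
    intro z
    split_ifs <;> simp <;> grind
  · rintro a b ⟨h1, h2, h3, h4⟩
    have key : ∀ z, z ≠ v → z ∈ (if z = u then ({u, v} : Set V) else if z = v then ∅ else {z}) := by
      intro z hz
      split_ifs <;> simp_all
    have kv : v ∈ (if u = u then ({u, v} : Set V) else if u = v then ∅ else {u}) := by simp
    rcases h4 with h' | ⟨h5, h'⟩ | ⟨h5, h'⟩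
    · exact ⟨a, key a h2, b, key b h3, h'⟩
    · subst h5
      exact ⟨v, kv, b, key b h3, h'⟩
    · subst h5
      exact ⟨a, key a h2, v, kv, h'.symm⟩

open Classical in
theorem contr_card {V : Type*} [Fintype V] (G : SimpleGraph V) {u v : V} (h : G.Adj u v) :
    G.edgeFinset.card ≤ (contr G u v).edgeFinset.card + 1 +
      (G.neighborFinset u ∩ G.neighborFinset v).card := by
  have h1 : G.edgeFinset.card = (G.edgeFinset \ G.incidenceFinset v).card + G.degree v := by
    rw [← G.card_incidenceFinset_eq_degree v]
    exact (Finset.card_sdiff_add_card_eq_card (G.incidenceFinset_subset v)).symm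
  have h2 : (G.edgeFinset \ G.incidenceFinset v) ∪
      ((G.neighborFinset v \ (G.neighborFinset u)).erase u).image (fun b => s(u, b)) ⊆
      (contr G u v).edgeFinset := by
    intro e he
    rw [Finset.mem_union] at he
    rcases he with he | he
    · rw [Finset.mem_sdiff] at he
      obtain ⟨he1, he2⟩ := he
      induction e with
      | h a b =>
        rw [SimpleGraph.mem_edgeFinset, SimpleGraph.mem_edgeSet] at he1 ⊢
        rw [SimpleGraph.mem_incidenceFinset, SimpleGraph.mk'_mem_incidenceSet_iff] at he2
        refine ⟨he1.ne, ?_, ?_, Or.inl he1⟩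
        · rintro rfl; exact he2 ⟨he1, Or.inl rfl⟩
        · rintro rfl; exact he2 ⟨he1, Or.inr rfl⟩
    · rw [Finset.mem_image] at he
      obtain ⟨b, hb, rfl⟩ := he
      simp only [Finset.mem_erase, Finset.mem_sdiff, SimpleGraph.mem_neighborFinset] at hb
      rw [SimpleGraph.mem_edgeFinset, SimpleGraph.mem_edgeSet]
      exact ⟨hb.1.symm, h.ne, hb.2.1.ne', Or.inr (Or.inl ⟨rfl, hb.2.1⟩)⟩
  have h3 : Disjoint (G.edgeFinset \ G.incidenceFinset v)
      (((G.neighborFinset v \ (G.neighborFinset u)).erase u).image (fun b => s(u, b))) := by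
    rw [Finset.disjoint_right]
    intro e he he'
    rw [Finset.mem_image] at he
    obtain ⟨b, hb, rfl⟩ := he
    simp only [Finset.mem_erase, Finset.mem_sdiff, SimpleGraph.mem_neighborFinset] at hb
    rw [Finset.mem_sdiff, SimpleGraph.mem_edgeFinset, SimpleGraph.mem_edgeSet] at he'
    exact hb.2.2 he'.1
  have h4 := Finset.card_le_card h2
  rw [Finset.card_union_of_disjoint h3, Finset.card_image_of_injective _ (by
    intro a b hab
    simp at hab
    grind)] at h4
  have h5 : G.degree v ≤ ((G.neighborFinset v \ (G.neighborFinset u)).erase u).card + 1 +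
      (G.neighborFinset u ∩ G.neighborFinset v).card := by
    rw [← SimpleGraph.card_neighborFinset_eq_degree]
    have e1 := Finset.card_sdiff_add_card_inter (G.neighborFinset v) (G.neighborFinset u)
    have e2 := Finset.pred_card_le_card_erase
      (s := G.neighborFinset v \ G.neighborFinset u) (a := u)
    rw [Finset.inter_comm] at e1
    omega
  omega

/-- Restriction of a graph to a vertex set, on the same vertex type. -/
def rstr {V : Type*} (G : SimpleGraph V) (X : Finset V) : SimpleGraph V where
  Adj a b := G.Adj a b ∧ a ∈ X ∧ b ∈ X
  symm := ⟨fun _ _ h => ⟨h.1.symm, h.2.2, h.2.1⟩⟩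
  loopless := ⟨fun _ h => h.1.ne rfl⟩

theorem rstr_le {V : Type*} (G : SimpleGraph V) (X : Finset V) : rstr G X ≤ G :=
  fun _ _ h => h.1


/-! ### Neighbourhoods of small-degree vertices -/

open Classical in
theorem exists_label {V : Type*} (N : Finset V) (z : V) (hz : z ∈ N) (T : Finset V)
    (hT : T ⊆ N.erase z) :
    ∃ p : ℕ → V, (∀ i j, i < N.card → j < N.card → p i = p j → i = j) ∧
      (∀ i < N.card, p i ∈ N) ∧ (∀ v ∈ N, ∃ i < N.card, p i = v) ∧ p 0 = z ∧
      ∀ j < N.card, (p j ∈ T ↔ 1 ≤ j ∧ j ≤ T.card) := by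
  set l : List V := z :: (T.toList ++ (N.erase z \ T).toList) with hl
  have hnd : l.Nodup := by
    rw [hl, List.nodup_cons, List.nodup_append]
    refine ⟨?_, T.nodup_toList, Finset.nodup_toList _, ?_⟩
    · simp only [List.mem_append, Finset.mem_toList, Finset.mem_sdiff]
      rintro (h | h)
      · exact Finset.notMem_erase z N (hT h)
      · exact Finset.notMem_erase z N h.1
    · intro a ha b hb hab
      subst hab
      rw [Finset.mem_toList] at ha hb
      exact (Finset.mem_sdiff.1 hb).2 ha
  have hlen : l.length = N.card := by
    have h1 := Finset.card_sdiff_add_card_eq_card hT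
    have h2 := Finset.card_erase_add_one hz
    simp only [hl, List.length_cons, List.length_append, Finset.length_toList]
    omega
  have hmem : ∀ v, v ∈ l ↔ v ∈ N := by
    intro v
    simp only [hl, List.mem_cons, List.mem_append, Finset.mem_toList, Finset.mem_sdiff]
    constructor
    · rintro (rfl | h | h)
      · exact hz
      · exact Finset.mem_of_mem_erase (hT h)
      · exact Finset.mem_of_mem_erase h.1
    · intro h
      by_cases hvz : v = z
      · exact Or.inl hvz
      · have := Finset.mem_erase.2 ⟨hvz, h⟩
        tauto
  have hp : ∀ i (hi : i < N.card), l.getD i z = l[i]'(by omega) := by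
    intro i hi
    rw [List.getD_eq_getElem]
  refine ⟨fun i => l.getD i z, ?_, ?_, ?_, ?_, ?_⟩
  · intro i j hi hj h
    simp only [hp i hi, hp j hj] at h
    exact (List.Nodup.getElem_inj_iff hnd).1 h
  · intro i hi
    simp only [hp i hi]
    exact (hmem _).1 (List.getElem_mem _)
  · intro v hv
    obtain ⟨i, hi, h⟩ := List.mem_iff_getElem.1 ((hmem v).2 hv)
    exact ⟨i, by omega, by simp only [hp i (by omega)]; exact h⟩
  · simp [hl]
  · intro j hj
    simp only [hp j hj]
    rcases j with _ | k
    · simp only [hl, List.getElem_cons_zero]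
      constructor
      · intro h; exact absurd (hT h) (Finset.notMem_erase z N)
      · intro h; omega
    · simp only [hl, List.getElem_cons_succ, List.getElem_append, Finset.length_toList]
      split
      · rename_i hk
        constructor
        · intro _; omega
        · intro _; exact Finset.mem_toList.1 (List.getElem_mem _)
      · rename_i hk
        constructor
        · intro h
          have : (N.erase z \ T).toList[k - T.card]'(by
            have := hlen; simp only [hl, List.length_cons, List.length_append,
              Finset.length_toList] at this ⊢; omega) ∈ (N.erase z \ T).toList :=
            List.getElem_mem _
          rw [Finset.mem_toList, Finset.mem_sdiff] at this
          exact absurd h this.2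
        · intro h; omega

/-- The exceptional structure of a neighbourhood. -/
def Excep (n : ℕ) (A : ℕ → ℕ → Prop) : Prop :=
  (∀ u w, u < n → w < n → u ≠ w → ¬ A u w →
      K5N n (fun i j => A i j ∨ (i = u ∧ j = w) ∨ (i = w ∧ j = u))) ∧
    (∀ i j k l, i < n → j < i → k < j → l < k →
      ¬ (A i j ∧ A i k ∧ A j k ∧ A i l ∧ A j l ∧ A k l)) ∧
    ∀ [DecidableRel A], ∑ i ∈ Finset.range n, ((Finset.range n).filter
      (fun j => j = i ∨ A i j)).card ≤ 7 * n - 12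

open Classical in
theorem local_struct {V : Type*} [Fintype V] (G : SimpleGraph V) (x : V) (h5 : 5 ≤ G.degree x)
    (h7 : G.degree x ≤ 7)
    (h4 : ∀ z, G.Adj x z → 4 ≤ (G.neighborFinset x ∩ G.neighborFinset z).card) :
    HasK6Minor G ∨ ∃ p : ℕ → V,
      (∀ i j, i < G.degree x → j < G.degree x → p i = p j → i = j) ∧
      (∀ i < G.degree x, G.Adj x (p i)) ∧ (∀ v, G.Adj x v → ∃ i < G.degree x, p i = v) ∧
      Excep (G.degree x) (fun i j => G.Adj (p i) (p j)) := by
  set N := G.neighborFinset x with hN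
  have hcard : N.card = G.degree x := G.card_neighborFinset_eq_degree x
  let T : V → Finset V := fun z => N.filter (fun v => v ≠ z ∧ ¬ G.Adj z v)
  have hTc : ∀ z ∈ N, (T z).card + 5 ≤ G.degree x := by
    intro z hz
    have h1 := h4 z ((G.mem_neighborFinset x z).1 hz)
    have h2 : T z ⊆ N.erase z \ (N ∩ G.neighborFinset z) := by
      intro v hv
      simp only [T, Finset.mem_filter] at hv
      simp only [Finset.mem_sdiff, Finset.mem_erase, Finset.mem_inter,
        SimpleGraph.mem_neighborFinset]
      tauto
    have h3 : N ∩ G.neighborFinset z ⊆ N.erase z := by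
      intro v hv
      rw [Finset.mem_inter] at hv
      exact Finset.mem_erase.2 ⟨((G.mem_neighborFinset z v).1 hv.2).ne', hv.1⟩
    have h4 := Finset.card_le_card h2
    have h5 := Finset.card_sdiff_add_card_eq_card h3
    have h6 := Finset.card_erase_add_one hz
    omega
  have hNe : N.Nonempty := by
    rw [← Finset.card_pos]; omega
  obtain ⟨z, hz, hmax⟩ := Finset.exists_max_image N (fun z => (T z).card) hNe
  obtain ⟨p, hinj, hmem, hsurj, hp0, hpT⟩ := exists_label N z hz (T z) (by
    intro v hv
    simp only [T, Finset.mem_filter] at hv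
    exact Finset.mem_erase.2 ⟨hv.2.1, hv.1⟩)
  rw [hcard] at hinj hmem hsurj hpT
  have hadj : ∀ i < G.degree x, G.Adj x (p i) := fun i hi =>
    (G.mem_neighborFinset x _).1 (hmem i hi)
  have hDz := hTc z hz
  have h0 : ∀ j < G.degree x, (j ≠ 0 ∧ ¬ G.Adj (p 0) (p j)) ↔ (1 ≤ j ∧ j ≤ (T z).card) := by
    intro j hj
    rw [← hpT j hj, hp0]
    simp only [T, Finset.mem_filter, hmem j hj, true_and]
    have : p j ≠ z ↔ j ≠ 0 := by
      rw [← hp0]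
      constructor
      · rintro h rfl; exact h rfl
      · intro h h'; exact h (hinj _ _ hj (by omega) h')
    rw [this]
  have hr : ∀ i < G.degree x, ((Finset.range (G.degree x)).filter
      (fun j => j ≠ i ∧ ¬ G.Adj (p i) (p j))).card ≤ (T z).card := by
    intro i hi
    refine le_trans ?_ (hmax (p i) (hmem i hi))
    apply Finset.card_le_card_of_injOn p
    · intro j hj
      simp only [Finset.coe_filter, Finset.mem_range, Set.mem_ofPred_eq] at hj
      simp only [T, Finset.coe_filter, Set.mem_ofPred_eq]
      refine ⟨hmem j hj.1, ?_, hj.2.2⟩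
      intro h
      exact hj.2.1 (hinj _ _ hj.1 hi h)
    · intro j hj k hk h
      simp only [Finset.coe_filter, Finset.mem_range, Set.mem_ofPred_eq] at hj hk
      exact hinj _ _ hj.1 hk.1 h
  by_cases hd5 : G.degree x = 5
  · left
    refine K6_of_K5N G x p 5 (by rw [← hd5]; exact hinj) (by rw [← hd5]; exact hadj)
      (fun i j => G.Adj (p i) (p j)) (fun _ _ _ _ h => h) ?_
    have hall : ∀ i j, i < 5 → j < 5 → i ≠ j → G.Adj (p i) (p j) := by
      intro i j hi hj hij
      by_contra hc
      have h1 := hr i (by omega)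
      have h2 : (T z).card = 0 := by omega
      rw [h2, Nat.le_zero, Finset.card_eq_zero] at h1
      have : j ∈ (Finset.range (G.degree x)).filter (fun j => j ≠ i ∧ ¬ G.Adj (p i) (p j)) := by
        rw [Finset.mem_filter, Finset.mem_range]
        exact ⟨by omega, hij.symm, hc⟩
      rw [h1] at this
      exact absurd this (Finset.notMem_empty j)
    refine ⟨fun i => (i.1, i.1), fun i => ⟨i.2, i.2⟩, fun i => Or.inl rfl, ?_⟩
    intro i j hij
    have : i.1 ≠ j.1 := fun h => hij (Fin.ext h)
    exact ⟨this, this, this, this, Or.inl (hall _ _ i.2 j.2 this)⟩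
  · have := fin_check (n := G.degree x) (D := (T z).card) (by omega)
      (A := fun i j => G.Adj (p i) (p j)) (fun i j h => h.symm) h0 hr
    rcases this with h | h
    · left
      exact K6_of_K5N G x p _ hinj hadj _ (fun _ _ _ _ h => h) h
    · right
      exact ⟨p, hinj, hadj, fun v hv => hsurj v ((G.mem_neighborFinset x v).2 hv), h⟩

/-! ### The induction step -/

/-- `G` restricted to the closed neighbourhood of `x`, with the pair `s t` joined. -/
def joined {V : Type*} (G : SimpleGraph V) (x s t : V) : SimpleGraph V where
  Adj a b := a ≠ b ∧ ((G.Adj a b ∧ (a = x ∨ G.Adj x a) ∧ (b = x ∨ G.Adj x b)) ∨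
    (a = s ∧ b = t) ∨ (a = t ∧ b = s))
  symm := ⟨by
    rintro a b ⟨h1, h⟩
    refine ⟨h1.symm, ?_⟩
    rcases h with ⟨h, h2, h3⟩ | h | h
    · exact Or.inl ⟨h.symm, h3, h2⟩
    · exact Or.inr (Or.inr ⟨h.2, h.1⟩)
    · exact Or.inr (Or.inl ⟨h.2, h.1⟩)⟩
  loopless := ⟨fun a h => h.1 rfl⟩

open Classical in
theorem joined_minor {V : Type*} (G : SimpleGraph V) {x s t : V} (hs : G.Adj x s)
    (ht : G.Adj x t) (hst : s ≠ t) (C : Set V) (hC : (G.induce C).Preconnected)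
    (hCx : ∀ c ∈ C, c ≠ x ∧ ¬ G.Adj x c) {c d : V} (hc : c ∈ C) (hcs : G.Adj c s) (hd : d ∈ C)
    (hdt : G.Adj d t) : MinorOf (joined G x s t) G := by
  refine ⟨fun w => if w = s then insert s C else if w = x ∨ G.Adj x w then {w} else ∅, ?_, ?_, ?_⟩
  · intro w
    dsimp only
    by_cases h1 : w = s
    · rw [if_pos h1]
      have hsub : C ⊆ insert s C := Set.subset_insert s C
      have key : ∀ a (ha : a ∈ insert s C), (G.induce (insert s C)).Reachable
          ⟨c, hsub hc⟩ ⟨a, ha⟩ := by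
        intro a ha
        rcases ha with rfl | ha
        · have : (G.induce (insert a C)).Adj ⟨c, hsub hc⟩ ⟨a, Or.inl rfl⟩ := hcs
          exact this.reachable
        · exact reach_mono hsub (hC ⟨c, hc⟩ ⟨a, ha⟩)
      rintro ⟨a, ha⟩ ⟨b, hb⟩
      exact (key a ha).symm.trans (key b hb)
    by_cases h2 : w = x ∨ G.Adj x w
    · rw [if_neg h1, if_pos h2]
      exact preconn_singleton G w
    · rw [if_neg h1, if_neg h2]
      exact preconn_empty G
  · intro i j hij
    dsimp only
    rw [Set.disjoint_left]
    intro z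
    have := hCx z
    split_ifs <;> simp <;> grind
  · have key : ∀ z, (z = x ∨ G.Adj x z) →
        z ∈ (if z = s then insert s C else if z = x ∨ G.Adj x z then {z} else ∅ : Set V) := by
      intro z hz
      split_ifs <;> simp_all
    have kd : d ∈ (if s = s then insert s C else if s = x ∨ G.Adj x s then {s} else ∅ : Set V) := by
      simp [hd]
    rintro a b ⟨h1, ⟨h2, h3, h4⟩ | ⟨ha, hb⟩ | ⟨ha, hb⟩⟩
    · exact ⟨a, key a h3, b, key b h4, h2⟩
    · subst ha; subst hb
      exact ⟨d, kd, b, key b (Or.inr ht), hdt⟩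
    · subst ha; subst hb
      exact ⟨a, key a (Or.inr ht), d, kd, hdt.symm⟩

open Classical in
theorem separation_card {V : Type*} [Fintype V] (G : SimpleGraph V) (A C S : Finset V)
    (hA : ∀ a b, G.Adj a b → a ∈ A) (hCS : Disjoint C S)
    (hn : ∀ c ∈ C, ∀ w, G.Adj c w → w ∈ C ∨ w ∈ S) (hSA : S ⊆ A)
    (hcl : ∀ s ∈ S, ∀ t ∈ S, s ≠ t → G.Adj s t) :
    G.edgeFinset.card + (if S.card = 3 then 2 else 0) ≤
      (rstr G (A \ C)).edgeFinset.card + (rstr G (C ∪ S)).edgeFinset.card := by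
  rw [← Finset.card_union_add_card_inter]
  refine add_le_add (Finset.card_le_card ?_) ?_
  · intro e he
    induction e with
    | h a b =>
      simp only [Finset.mem_union, SimpleGraph.mem_edgeFinset, SimpleGraph.mem_edgeSet] at he ⊢
      have ha := hA a b he
      have hb := hA b a he.symm
      have h1 := hn a
      have h2 := hn b
      by_cases hac : a ∈ C
      · right
        exact ⟨he, Finset.mem_union_left _ hac, Finset.mem_union.2 (h1 hac b he)⟩
      by_cases hbc : b ∈ C
      · right
        exact ⟨he, Finset.mem_union.2 (h2 hbc a he.symm), Finset.mem_union_left _ hbc⟩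
      · left
        exact ⟨he, Finset.mem_sdiff.2 ⟨ha, hac⟩, Finset.mem_sdiff.2 ⟨hb, hbc⟩⟩
  · split_ifs with h3
    · obtain ⟨a, b, c, hab, hac, hbc, rfl⟩ := Finset.card_eq_three.1 h3
      have hsub : ({s(a, b), s(a, c)} : Finset (Sym2 V)) ⊆
          (rstr G (A \ C)).edgeFinset ∩ (rstr G (C ∪ {a, b, c})).edgeFinset := by
        have hm : ∀ s ∈ ({a, b, c} : Finset V), s ∈ A \ C := fun s hs =>
          Finset.mem_sdiff.2 ⟨hSA hs, fun h => Finset.disjoint_left.1 hCS h hs⟩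
        have hE : ∀ s ∈ ({a, b, c} : Finset V), ∀ t ∈ ({a, b, c} : Finset V), s ≠ t →
            s(s, t) ∈ (rstr G (A \ C)).edgeFinset ∩ (rstr G (C ∪ {a, b, c})).edgeFinset := by
          intro s hs t ht hst
          rw [Finset.mem_inter, SimpleGraph.mem_edgeFinset, SimpleGraph.mem_edgeFinset]
          have := hcl s hs t ht hst
          exact ⟨⟨this, hm s hs, hm t ht⟩, ⟨this, Finset.mem_union_right _ hs,
            Finset.mem_union_right _ ht⟩⟩
        intro e he
        rw [Finset.mem_insert, Finset.mem_singleton] at he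
        rcases he with rfl | rfl
        · exact hE a (by simp) b (by simp) hab
        · exact hE a (by simp) c (by simp) hac
      have h2 : ({s(a, b), s(a, c)} : Finset (Sym2 V)).card = 2 := by
        apply Finset.card_pair
        intro h
        simp at h
        grind
      rw [← h2]
      exact Finset.card_le_card hsub
    · exact Nat.zero_le _


/-- The inductive hypothesis: the theorem for smaller supports. -/
def MaderBelow (V : Type*) [Fintype V] (m : ℕ) : Prop :=
  ∀ (G : SimpleGraph V) (A : Finset V), A.card < m → 6 ≤ A.card → (∀ a b, G.Adj a b → a ∈ A) →
    4 * A.card ≤ G.edgeSet.ncard + 9 → HasK6Minor G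

open Classical in
theorem ncard_edge {V : Type*} [Fintype V] (G : SimpleGraph V) :
    G.edgeSet.ncard = G.edgeFinset.card := by
  rw [← SimpleGraph.coe_edgeFinset, Set.ncard_coe_finset]

open Classical in
theorem sum_deg {V : Type*} [Fintype V] (G : SimpleGraph V) (A : Finset V)
    (hA : ∀ a b, G.Adj a b → a ∈ A) : ∑ v ∈ A, G.degree v = 2 * G.edgeFinset.card := by
  rw [← G.sum_degrees_eq_twice_card_edges]
  apply Finset.sum_subset (Finset.subset_univ A)
  intro v _ hv
  rw [← SimpleGraph.card_neighborFinset_eq_degree, Finset.card_eq_zero]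
  ext w
  simp only [SimpleGraph.mem_neighborFinset, Finset.notMem_empty, iff_false]
  exact fun h => hv (hA v w h)

open Classical in
theorem component_exists {V : Type*} [Fintype V] (G : SimpleGraph V) (x y : V) (hy : y ≠ x)
    (hxy : ¬ G.Adj x y) : ∃ C : Finset V, y ∈ C ∧ (∀ c ∈ C, c ≠ x ∧ ¬ G.Adj x c) ∧
      (∀ c ∈ C, ∀ w, G.Adj c w → w ∈ C ∨ G.Adj x w) ∧
      (∀ c ∈ C, c = y ∨ ∃ w, G.Adj c w) ∧
      (G.induce (C : Set V)).Preconnected := by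
  let O : Set V := {v | v ≠ x ∧ ¬ G.Adj x v}
  have hyO : y ∈ O := ⟨hy, hxy⟩
  let C : Finset V := Finset.univ.filter
    (fun c => ∃ h : c ∈ O, (G.induce O).Reachable ⟨y, hyO⟩ ⟨c, h⟩)
  have hmem : ∀ c, c ∈ C ↔ ∃ h : c ∈ O, (G.induce O).Reachable ⟨y, hyO⟩ ⟨c, h⟩ := by
    intro c; simp [C]
  have hyC : y ∈ C := (hmem y).2 ⟨hyO, SimpleGraph.Reachable.refl _⟩
  have key : ∀ z : O, Relation.ReflTransGen (G.induce O).Adj ⟨y, hyO⟩ z →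
      (z.1 = y ∨ ∃ w, G.Adj z.1 w) ∧
      ∃ hz : z.1 ∈ (C : Set V), (G.induce (C : Set V)).Reachable ⟨y, hyC⟩ ⟨z.1, hz⟩ := by
    intro z hz
    induction hz with
    | refl => exact ⟨Or.inl rfl, hyC, SimpleGraph.Reachable.refl _⟩
    | @tail b c hb hbc ih =>
      obtain ⟨_, hbC, hr⟩ := ih
      have hcC : c.1 ∈ C := (hmem _).2 ⟨c.2, by
        rw [SimpleGraph.reachable_iff_reflTransGen]
        exact hb.tail hbc⟩
      have hadj : (G.induce (C : Set V)).Adj ⟨b.1, hbC⟩ ⟨c.1, hcC⟩ := hbc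
      exact ⟨Or.inr ⟨b.1, SimpleGraph.Adj.symm hbc⟩, hcC, hr.trans hadj.reachable⟩
  have key' : ∀ c ∈ C, (c = y ∨ ∃ w, G.Adj c w) ∧
      ∃ hz : c ∈ (C : Set V), (G.induce (C : Set V)).Reachable ⟨y, hyC⟩ ⟨c, hz⟩ := by
    intro c hc
    obtain ⟨h, hr⟩ := (hmem c).1 hc
    rw [SimpleGraph.reachable_iff_reflTransGen] at hr
    exact key ⟨c, h⟩ hr
  refine ⟨C, hyC, ?_, ?_, fun c hc => (key' c hc).1, ?_⟩
  · intro c hc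
    exact ((hmem c).1 hc).1
  · intro c hc w hcw
    obtain ⟨h, hr⟩ := (hmem c).1 hc
    by_cases hxw : G.Adj x w
    · exact Or.inr hxw
    left
    have hwO : w ∈ O := by
      refine ⟨?_, hxw⟩
      rintro rfl
      exact h.2 hcw.symm
    have hadj : (G.induce O).Adj ⟨c, h⟩ ⟨w, hwO⟩ := hcw
    exact (hmem w).2 ⟨hwO, hr.trans hadj.reachable⟩
  · rintro ⟨a, ha⟩ ⟨b, hb⟩
    obtain ⟨_, _, ra⟩ := key' a ha
    obtain ⟨_, _, rb⟩ := key' b hb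
    exact ra.symm.trans rb

open Classical in
theorem mader_step {V : Type*} [Fintype V] (G : SimpleGraph V) (A : Finset V)
    (ih : MaderBelow V A.card) (h7 : 7 ≤ A.card) (hA : ∀ a b, G.Adj a b → a ∈ A)
    (he : 4 * A.card = G.edgeFinset.card + 9) : HasK6Minor G := by
  by_contra hno
  -- no isolated vertices
  have hiso : ∀ v ∈ A, ∃ w, G.Adj v w := by
    intro v hv
    by_contra hc
    push Not at hc
    apply hno
    have hc1 := Finset.card_erase_add_one hv
    refine ih G (A.erase v) (by omega) (by omega) ?_ (by rw [ncard_edge]; omega)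
    intro a b hab
    refine Finset.mem_erase.2 ⟨?_, hA a b hab⟩
    rintro rfl
    exact hc b hab
  -- every edge lies in four triangles
  have htri : ∀ u v, G.Adj u v → 4 ≤ (G.neighborFinset u ∩ G.neighborFinset v).card := by
    intro u v huv
    by_contra hc
    push Not at hc
    apply hno
    have hv : v ∈ A := hA v u huv.symm
    have hc1 := Finset.card_erase_add_one hv
    have hc2 := contr_card G huv
    refine (contr_minor G huv).hasK6
      (ih _ (A.erase v) (by omega) (by omega) ?_ (by rw [ncard_edge]; omega))
    rintro a b ⟨h1, h2, h3, h4⟩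
    refine Finset.mem_erase.2 ⟨h2, ?_⟩
    rcases h4 with h | ⟨rfl, h⟩ | ⟨rfl, h⟩
    · exact hA _ _ h
    · exact hA _ _ huv
    · exact hA _ _ h.symm
  have hdeg5 : ∀ v ∈ A, 5 ≤ G.degree v := by
    intro v hv
    obtain ⟨w, hw⟩ := hiso v hv
    have h1 := htri v w hw
    have h2 : insert w (G.neighborFinset v ∩ G.neighborFinset w) ⊆ G.neighborFinset v := by
      intro z hz
      rcases Finset.mem_insert.1 hz with rfl | hz
      · exact (G.mem_neighborFinset _ _).2 hw
      · exact (Finset.mem_inter.1 hz).1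
    have h3 : w ∉ G.neighborFinset v ∩ G.neighborFinset w := by
      simp
    have h4 := Finset.card_le_card h2
    rw [Finset.card_insert_of_notMem h3, SimpleGraph.card_neighborFinset_eq_degree] at h4
    omega
  have hsum := sum_deg G A hA
  obtain ⟨x, hxA, hx7⟩ : ∃ x ∈ A, G.degree x ≤ 7 := by
    by_contra hc
    push Not at hc
    have : ∑ v ∈ A, 8 ≤ ∑ v ∈ A, G.degree v := Finset.sum_le_sum (fun v hv => hc v hv)
    rw [Finset.sum_const, smul_eq_mul] at this
    omega
  have hx5 := hdeg5 x hxA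
  rcases local_struct G x hx5 hx7 (fun z hz => htri x z hz) with h | ⟨p, hinj, hadj, hsurj, hE⟩
  · exact hno h
  set n := G.degree x with hn
  obtain ⟨hE1, hE2, hE3⟩ := hE
  by_cases hO : ∃ y ∈ A, y ≠ x ∧ ¬ G.Adj x y
  · obtain ⟨y, hyA, hyx, hxy⟩ := hO
    obtain ⟨C, hyC, hCx, hCn, hCi, hCc⟩ := component_exists G x y hyx hxy
    have hCA : C ⊆ A := by
      intro c hc
      rcases hCi c hc with rfl | ⟨w, hw⟩
      · exact hyA
      · exact hA c w hw
    let S : Finset V := Finset.univ.filter (fun s => G.Adj x s ∧ ∃ c ∈ C, G.Adj c s)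
    have hS : ∀ s, s ∈ S ↔ G.Adj x s ∧ ∃ c ∈ C, G.Adj c s := by
      intro s; simp [S]
    have hclq : ∀ s ∈ S, ∀ t ∈ S, s ≠ t → G.Adj s t := by
      intro s hs t ht hst
      by_contra hnadj
      obtain ⟨hxs, c, hc, hcs⟩ := (hS s).1 hs
      obtain ⟨hxt, d, hd, hdt⟩ := (hS t).1 ht
      apply hno
      apply (joined_minor G hxs hxt hst (C : Set V) hCc hCx hc hcs hd hdt).hasK6
      obtain ⟨i, hi, rfl⟩ := hsurj s hxs
      obtain ⟨j, hj, rfl⟩ := hsurj t hxt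
      refine K6_of_K5N _ x p n hinj ?_ _ ?_ (hE1 i j hi hj (fun h => hst (by rw [h])) hnadj)
      · intro k hk
        exact ⟨(hadj k hk).ne, Or.inl ⟨hadj k hk, Or.inl rfl, Or.inr (hadj k hk)⟩⟩
      · rintro k l hk hl (h | ⟨rfl, rfl⟩ | ⟨rfl, rfl⟩)
        · exact ⟨h.ne, Or.inl ⟨h, Or.inr (hadj k hk), Or.inr (hadj l hl)⟩⟩
        · exact ⟨hst, Or.inr (Or.inl ⟨rfl, rfl⟩)⟩
        · exact ⟨hst.symm, Or.inr (Or.inr ⟨rfl, rfl⟩)⟩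
    have hS3 : S.card ≤ 3 := by
      by_contra hc
      push Not at hc
      have hle : S.card ≤ ((Finset.range n).filter (fun i => p i ∈ S)).card := by
        apply Finset.card_le_card_of_surjOn p
        intro s hs
        obtain ⟨i, hi, rfl⟩ := hsurj s ((hS s).1 hs).1
        exact ⟨i, by simpa using ⟨hi, hs⟩, rfl⟩
      obtain ⟨T, hT, hT4⟩ := Finset.exists_subset_card_eq (le_trans hc hle)
      have hT4' : T.card = 4 := hT4
      let f := T.orderEmbOfFin hT4'
      have hf : ∀ i, f i < n ∧ p (f i) ∈ S := by
        intro i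
        have := hT (T.orderEmbOfFin_mem hT4' i)
        simpa using this
      have hlt : ∀ i j : Fin 4, i < j → f i < f j := fun i j h => f.strictMono h
      have hadj' : ∀ i j : Fin 4, i < j → G.Adj (p (f j)) (p (f i)) := by
        intro i j hij
        apply hclq _ (hf j).2 _ (hf i).2
        intro h
        have := hinj _ _ (hf j).1 (hf i).1 h
        have := hlt i j hij
        omega
      exact hE2 (f 3) (f 2) (f 1) (f 0) (hf 3).1 (hlt _ _ (by decide)) (hlt _ _ (by decide))
        (hlt _ _ (by decide)) ⟨hadj' _ _ (by decide), hadj' _ _ (by decide),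
          hadj' _ _ (by decide), hadj' _ _ (by decide), hadj' _ _ (by decide),
          hadj' _ _ (by decide)⟩
    have hCS : Disjoint C S := by
      rw [Finset.disjoint_left]
      intro c hc hs
      exact (hCx c hc).2 ((hS c).1 hs).1
    have hSA : S ⊆ A := fun s hs => hA s x ((hS s).1 hs).1.symm
    have hsep := separation_card G A C S hA hCS (by
      intro c hc w hcw
      rcases hCn c hc w hcw with h | h
      · exact Or.inl h
      · exact Or.inr ((hS w).2 ⟨h, c, hc, hcw⟩)) hSA hclq
    have c1 : (A \ C).card + C.card = A.card := Finset.card_sdiff_add_card_eq_card hCA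
    have c2 : (C ∪ S).card = C.card + S.card := Finset.card_union_of_disjoint hCS
    have c3 : 6 ≤ (A \ C).card := by
      have hsub : insert x (G.neighborFinset x) ⊆ A \ C := by
        intro v hv
        rcases Finset.mem_insert.1 hv with rfl | hv
        · exact Finset.mem_sdiff.2 ⟨hxA, fun h => (hCx _ h).1 rfl⟩
        · have hv := (G.mem_neighborFinset x v).1 hv
          exact Finset.mem_sdiff.2 ⟨hA v x hv.symm, fun h => (hCx _ h).2 hv⟩
      have := Finset.card_le_card hsub
      rw [Finset.card_insert_of_notMem (by simp), SimpleGraph.card_neighborFinset_eq_degree] at this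
      omega
    have c4 : 6 ≤ (C ∪ S).card := by
      have hsub : insert y (G.neighborFinset y) ⊆ C ∪ S := by
        intro v hv
        rcases Finset.mem_insert.1 hv with rfl | hv
        · exact Finset.mem_union_left _ hyC
        · have hv := (G.mem_neighborFinset y v).1 hv
          rcases hCn y hyC v hv with h | h
          · exact Finset.mem_union_left _ h
          · exact Finset.mem_union_right _ ((hS v).2 ⟨h, y, hyC, hv⟩)
      have := Finset.card_le_card hsub
      rw [Finset.card_insert_of_notMem (by simp), SimpleGraph.card_neighborFinset_eq_degree] at this
      have := hdeg5 y hyA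
      omega
    have c5 : 0 < C.card := Finset.card_pos.2 ⟨y, hyC⟩
    have c6 : (C ∪ S).card < A.card := by
      apply Finset.card_lt_card
      rw [Finset.ssubset_iff_of_subset (Finset.union_subset hCA hSA)]
      refine ⟨x, hxA, ?_⟩
      rw [Finset.mem_union]
      rintro (h | h)
      · exact (hCx x h).1 rfl
      · exact ((hS x).1 h).1.ne rfl
    have n1 : ¬ 4 * (A \ C).card ≤ (rstr G (A \ C)).edgeFinset.card + 9 := by
      intro h
      exact hno (hasK6_mono (rstr_le G (A \ C)) (ih _ (A \ C) (by omega) c3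
        (fun a b h => h.2.1) (by rw [ncard_edge]; exact h)))
    have n2 : ¬ 4 * (C ∪ S).card ≤ (rstr G (C ∪ S)).edgeFinset.card + 9 := by
      intro h
      exact hno (hasK6_mono (rstr_le G (C ∪ S)) (ih _ (C ∪ S) c6 c4
        (fun a b h => h.2.1) (by rw [ncard_edge]; exact h)))
    split_ifs at hsep <;> omega
  · push Not at hO
    have hAeq : A = insert x (G.neighborFinset x) := by
      ext v
      rw [Finset.mem_insert, SimpleGraph.mem_neighborFinset]
      constructor
      · intro hv
        by_cases hvx : v = x
        · exact Or.inl hvx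
        · exact Or.inr (hO v hv hvx)
      · rintro (rfl | h)
        · exact hxA
        · exact hA v x h.symm
    have hAcard : A.card = n + 1 := by
      rw [hAeq, Finset.card_insert_of_notMem (by simp), SimpleGraph.card_neighborFinset_eq_degree]
    have himg : G.neighborFinset x = (Finset.range n).image p := by
      ext v
      rw [SimpleGraph.mem_neighborFinset, Finset.mem_image]
      constructor
      · intro h
        obtain ⟨i, hi, rfl⟩ := hsurj v h
        exact ⟨i, Finset.mem_range.2 hi, rfl⟩
      · rintro ⟨i, hi, rfl⟩
        exact hadj i (Finset.mem_range.1 hi)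
    have hs2 : ∑ v ∈ A, G.degree v = n + ∑ i ∈ Finset.range n, G.degree (p i) := by
      rw [hAeq, Finset.sum_insert (by simp), himg, Finset.sum_image]
      intro i hi j hj h
      exact hinj i j (by simpa using hi) (by simpa using hj) h
    have hs3 : ∑ i ∈ Finset.range n, G.degree (p i) ≤ ∑ i ∈ Finset.range n,
        ((Finset.range n).filter (fun j => j = i ∨ G.Adj (p i) (p j))).card := by
      apply Finset.sum_le_sum
      intro i hi
      have hi' := Finset.mem_range.1 hi
      rw [← SimpleGraph.card_neighborFinset_eq_degree]
      apply Finset.card_le_card_of_surjOn (fun j => if j = i then x else p j)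
      intro v hv
      have hv' : G.Adj (p i) v := by simpa using hv
      have hvA := hA v _ hv'.symm
      by_cases hvx : v = x
      · exact ⟨i, by simpa using hi', by simp [hvx]⟩
      · obtain ⟨j, hj, rfl⟩ := hsurj v (hO v hvA hvx)
        have hji : j ≠ i := by
          rintro rfl
          exact hv'.ne rfl
        refine ⟨j, ?_, by simp [hji]⟩
        simp only [Finset.coe_filter, Finset.mem_range, Set.mem_ofPred_eq]
        exact ⟨hj, Or.inr hv'⟩
    have hs4 : ∑ i ∈ Finset.range n, ((Finset.range n).filter
        (fun j => j = i ∨ G.Adj (p i) (p j))).card ≤ 7 * n - 12 := by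
      convert hE3
    omega

open Classical in
theorem mader_six {V : Type*} [Fintype V] (G : SimpleGraph V) (A : Finset V)
    (h6 : A.card = 6) (hA : ∀ a b, G.Adj a b → a ∈ A)
    (he : 15 ≤ G.edgeFinset.card) : HasK6Minor G := by
  have hsum := sum_deg G A hA
  have hsub : ∀ v ∈ A, G.neighborFinset v ⊆ A.erase v := by
    intro v hv w hw
    have hw := (G.mem_neighborFinset v w).1 hw
    exact Finset.mem_erase.2 ⟨hw.ne', hA w v hw.symm⟩
  have hle : ∀ v ∈ A, G.degree v ≤ 5 := by
    intro v hv
    have := Finset.card_le_card (hsub v hv)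
    rw [SimpleGraph.card_neighborFinset_eq_degree, Finset.card_erase_of_mem hv] at this
    omega
  have hall : ∀ u ∈ A, ∀ v ∈ A, u ≠ v → G.Adj u v := by
    intro u hu v hv huv
    by_contra hc
    have hlt : G.degree u < 5 := by
      have h1 : G.neighborFinset u ⊆ (A.erase u).erase v := by
        intro w hw
        refine Finset.mem_erase.2 ⟨?_, hsub u hu hw⟩
        rintro rfl
        exact hc ((G.mem_neighborFinset _ _).1 hw)
      have := Finset.card_le_card h1
      rw [SimpleGraph.card_neighborFinset_eq_degree, Finset.card_erase_of_mem
        (Finset.mem_erase.2 ⟨huv.symm, hv⟩), Finset.card_erase_of_mem hu] at this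
      omega
    have : ∑ v ∈ A, G.degree v < ∑ v ∈ A, 5 := Finset.sum_lt_sum hle ⟨u, hu, hlt⟩
    rw [Finset.sum_const, smul_eq_mul] at this
    omega
  let e := (A.equivFinOfCardEq h6).symm
  refine ⟨fun i => {(e i).1}, fun i => ⟨_, rfl⟩, ?_, ?_, ?_⟩
  · intro i j hij
    simp only [Set.disjoint_singleton]
    intro h
    exact hij (e.injective (Subtype.ext h))
  · intro i
    rw [SimpleGraph.connected_iff]
    exact ⟨preconn_singleton G _, ⟨⟨_, rfl⟩⟩⟩
  · intro i j hij
    exact ⟨_, rfl, _, rfl, hall _ (e i).2 _ (e j).2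
      (fun h => hij (e.injective (Subtype.ext h)))⟩

open Classical in
theorem mader_all {V : Type*} [Fintype V] (m : ℕ) : MaderBelow V m := by
  induction m with
  | zero => intro G A h; omega
  | succ m ih =>
    intro G A hlt h6 hA he
    rw [ncard_edge] at he
    by_cases hm : A.card < m
    · exact ih G A hm h6 hA (by rw [ncard_edge]; exact he)
    obtain rfl : m = A.card := by omega
    by_cases h7 : A.card = 6
    · exact mader_six G A h7 hA (by omega)
    obtain ⟨E, hE, hEc⟩ := Finset.exists_subset_card_eq
      (show 4 * A.card - 9 ≤ G.edgeFinset.card by omega)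
    have hsubE : ∀ e ∈ E, e ∈ G.edgeSet := fun e he => SimpleGraph.mem_edgeFinset.1 (hE he)
    have hle : SimpleGraph.fromEdgeSet (E : Set (Sym2 V)) ≤ G := by
      intro a b h
      rw [SimpleGraph.fromEdgeSet_adj] at h
      exact hsubE _ h.1
    have hedges : (SimpleGraph.fromEdgeSet (E : Set (Sym2 V))).edgeFinset = E := by
      ext e
      rw [SimpleGraph.mem_edgeFinset, SimpleGraph.edgeSet_fromEdgeSet]
      constructor
      · intro h; exact h.1
      · intro h; exact ⟨h, G.not_isDiag_of_mem_edgeSet (hsubE e h)⟩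
    apply hasK6_mono hle
    apply mader_step _ A ih (by omega) (fun a b h => hA a b (hle h))
    have hc : (SimpleGraph.fromEdgeSet (E : Set (Sym2 V))).edgeSet.ncard = 4 * A.card - 9 := by
      rw [← hEc, ← Set.ncard_coe_finset E, ← hedges, SimpleGraph.coe_edgeFinset, SimpleGraph.fromEdgeSet_edgeSet]
    rw [← ncard_edge]
    omega

/-- There is a constant `c(6)` such that every graph on `n` vertices with more
than `c(6)·n` edges contains `K₆` as a minor; in Mader's specific form, every
graph on `n ≥ 6` vertices with more than `4n - 10` edges has a `K₆` minor. -/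
theorem mader_K6_minor :
    (∃ c : ℕ, ∀ (n : ℕ) (G : SimpleGraph (Fin n)),
      c * n < G.edgeSet.ncard → HasK6Minor G) ∧
    (∀ (n : ℕ) (G : SimpleGraph (Fin n)), 6 ≤ n →
      4 * n - 10 < G.edgeSet.ncard → HasK6Minor G) := by
  have main : ∀ (n : ℕ) (G : SimpleGraph (Fin n)), 6 ≤ n →
      4 * n - 10 < G.edgeSet.ncard → HasK6Minor G := by
    intro n G hn he
    refine mader_all (n + 1) G Finset.univ (by simp) (by simpa using hn)
      (fun a _ _ => Finset.mem_univ a) ?_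
    rw [Finset.card_univ, Fintype.card_fin]
    omega
  refine ⟨⟨4, ?_⟩, main⟩
  intro n G he
  by_cases hn : 6 ≤ n
  · exact main n G hn (by omega)
  · exfalso
    classical
    rw [ncard_edge] at he
    have := G.card_edgeFinset_le_card_choose_two
    rw [Fintype.card_fin] at this
    have h5 : n ≤ 5 := by omega
    have h2 : n.choose 2 ≤ 4 * n := by
      clear he this G
      interval_cases n <;> decide
    omega
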